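/- arXiv:0810.3888 — 4 statements merged into one kernel-verified Lean document; each statement's English description precedes it below -/
import Mathlib

section
/- Let V be a real vector space with quaternionic structure (I₁,I₂,I₃), let n be a real number, let T⁰ be a bilinear form on V satisfying T⁰(X,Y) + T⁰(I₁X,I₁Y) + T⁰(I₂X,I₂Y) + T⁰(I₃X,I₃Y) = 0, and let U be a bilinear form on V satisfying 3U(X,Y) − U(I₁X,I₁Y) − U(I₂X,I₂Y) − U(I₃X,I₃Y) = 0. For every cyclic permutation (i,j,k) of (1,2,3) define B_k(X,Y) := 2(n−1)[T⁰(X,Y) + T⁰(I_kX,I_kY)] + 8n U(X,Y). Then for every cyclic permutation (i,j,k) of (1,2,3) and all X, Y ∈ V one has B_k(X,Y) + B_k(I_iX, I_iY) = 16n U(X,Y); in particular, if n ≠ 0 then U(X,Y) = (1/16n)[B_k(X,Y) + B_k(I_iX, I_iY)]. -/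
/-- `B_k(X,Y) = 2(n−1)[T⁰(X,Y) + T⁰(I_kX,I_kY)] + 8n U(X,Y)`,
which in the paper equals `−Σ_a dΩ(ξ_i, X, I_kY, e_a, I_je_a)` by (5.6). -/
def torsionB {V : Type*} [AddCommGroup V] [Module ℝ V]
    (n : ℝ) (T U : V →ₗ[ℝ] V →ₗ[ℝ] ℝ) (Ik : Module.End ℝ V) (X Y : V) : ℝ :=
  2 * (n - 1) * (T X Y + T (Ik X) (Ik Y)) + 8 * n * U X Y

/-- the algebraic core of formula (5.1) of Lemma 4.1:
for every cyclic permutation `(i,j,k)` of `(1,2,3)`,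
`B_k(X,Y) + B_k(I_iX, I_iY) = 16n U(X,Y)`; in particular, if `n ≠ 0` then
`U(X,Y) = (1/16n)[B_k(X,Y) + B_k(I_iX, I_iY)]`. -/
theorem torsionB_recovers_U
    {V : Type*} [AddCommGroup V] [Module ℝ V]
    (I1 I2 I3 : Module.End ℝ V)
    (hI1 : I1 * I1 = -1) (hI2 : I2 * I2 = -1) (hI3 : I3 * I3 = -1)
    (hI12 : I1 * I2 = I3) (hI21 : I2 * I1 = -I3)
    (n : ℝ) (T U : V →ₗ[ℝ] V →ₗ[ℝ] ℝ)
    (hT : ∀ X Y : V,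
      T X Y + T (I1 X) (I1 Y) + T (I2 X) (I2 Y) + T (I3 X) (I3 Y) = 0)
    (hU : ∀ X Y : V,
      3 * U X Y - U (I1 X) (I1 Y) - U (I2 X) (I2 Y) - U (I3 X) (I3 Y) = 0) :
    (∀ X Y : V,
      (torsionB n T U I3 X Y + torsionB n T U I3 (I1 X) (I1 Y) = 16 * n * U X Y) ∧
      (torsionB n T U I1 X Y + torsionB n T U I1 (I2 X) (I2 Y) = 16 * n * U X Y) ∧
      (torsionB n T U I2 X Y + torsionB n T U I2 (I3 X) (I3 Y) = 16 * n * U X Y)) ∧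
    (n ≠ 0 → ∀ X Y : V,
      (U X Y = 1 / (16 * n) * (torsionB n T U I3 X Y + torsionB n T U I3 (I1 X) (I1 Y))) ∧
      (U X Y = 1 / (16 * n) * (torsionB n T U I1 X Y + torsionB n T U I1 (I2 X) (I2 Y))) ∧
      (U X Y = 1 / (16 * n) * (torsionB n T U I2 X Y + torsionB n T U I2 (I3 X) (I3 Y)))) := by
  have h31 : I3 * I1 = I2 := by
    rw [← hI12, mul_assoc, hI21, ← hI12, mul_neg, ← mul_assoc, hI1, neg_one_mul, neg_neg]
  have h32 : I3 * I2 = -I1 := by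
    rw [← hI12, mul_assoc, hI2, mul_neg, mul_one]
  have h23 : I2 * I3 = I1 := by
    rw [← hI12, ← mul_assoc, hI21, neg_mul, h32, neg_neg]
  have e11 (Z : V) : I1 (I1 Z) = -Z := LinearMap.congr_fun hI1 Z
  have e22 (Z : V) : I2 (I2 Z) = -Z := LinearMap.congr_fun hI2 Z
  have e12 (Z : V) : I1 (I2 Z) = I3 Z := LinearMap.congr_fun hI12 Z
  have e21 (Z : V) : I2 (I1 Z) = -I3 Z := LinearMap.congr_fun hI21 Z
  have e31 (Z : V) : I3 (I1 Z) = I2 Z := LinearMap.congr_fun h31 Z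
  have e32 (Z : V) : I3 (I2 Z) = -I1 Z := LinearMap.congr_fun h32 Z
  have e23 (Z : V) : I2 (I3 Z) = I1 Z := LinearMap.congr_fun h23 Z
  have u1 (X Y : V) : U (I1 X) (I1 Y) = U X Y := by
    have h := hU (I1 X) (I1 Y)
    simp only [e11, e21, e31, map_neg, LinearMap.neg_apply, neg_neg] at h
    linarith [hU X Y]
  have u2 (X Y : V) : U (I2 X) (I2 Y) = U X Y := by
    have h := hU (I2 X) (I2 Y)
    simp only [e12, e22, e32, map_neg, LinearMap.neg_apply, neg_neg] at h
    linarith [hU X Y]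
  have u3 (X Y : V) : U (I3 X) (I3 Y) = U X Y := by
    linarith [hU X Y, u1 X Y, u2 X Y]
  have key (X Y : V) :
      (torsionB n T U I3 X Y + torsionB n T U I3 (I1 X) (I1 Y) = 16 * n * U X Y) ∧
      (torsionB n T U I1 X Y + torsionB n T U I1 (I2 X) (I2 Y) = 16 * n * U X Y) ∧
      (torsionB n T U I2 X Y + torsionB n T U I2 (I3 X) (I3 Y) = 16 * n * U X Y) := by
    simp only [torsionB, e31, e12, e23, u1, u2, u3]
    refine ⟨?_, ?_, ?_⟩ <;> linear_combination 2 * (n - 1) * hT X Y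
  refine ⟨key, fun hn X Y => ?_⟩
  obtain ⟨h3, h1, h2⟩ := key X Y
  rw [h3, h1, h2]
  have h : U X Y = 1 / (16 * n) * (16 * n * U X Y) := by field_simp
  exact ⟨h, h, h⟩
end

section
/- Let V be a real vector space with quaternionic structure (I₁,I₂,I₃), let n be a real number, let T⁰ be a bilinear form on V satisfying T⁰(X,Y) + T⁰(I₁X,I₁Y) + T⁰(I₂X,I₂Y) + T⁰(I₃X,I₃Y) = 0, and let U be a bilinear form on V satisfying 3U(X,Y) − U(I₁X,I₁Y) − U(I₂X,I₂Y) − U(I₃X,I₃Y) = 0. For every cyclic permutation (i,j,k) of (1,2,3) define B_k(X,Y) := 2(n−1)[T⁰(X,Y) + T⁰(I_kX,I_kY)] + 8n U(X,Y). Then for all X, Y ∈ V the sum over the three cyclic permutations (i,j,k) of (1,2,3) satisfies Σ_{(ijk)} [B_k(X,Y) − B_k(I_iX, I_iY)] = 8(n−1) T⁰(X,Y); in particular, if n ≠ 1 then T⁰(X,Y) = (1/(8(n−1))) Σ_{(ijk)} [B_k(X,Y) − B_k(I_iX, I_iY)]. -/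
/-- the algebraic core of formula (5.2) of Lemma 4.1:
`Σ_{(ijk)} [B_k(X,Y) − B_k(I_iX, I_iY)] = 8(n−1) T⁰(X,Y)` where the sum is over
the three cyclic permutations of `(1,2,3)`; in particular, if `n ≠ 1` then
`T⁰(X,Y) = (1/(8(n−1))) Σ_{(ijk)} [B_k(X,Y) − B_k(I_iX, I_iY)]`. -/
theorem torsionB_recovers_T0
    {V : Type*} [AddCommGroup V] [Module ℝ V]
    (I1 I2 I3 : Module.End ℝ V)
    (hI1 : I1 * I1 = -1) (hI2 : I2 * I2 = -1) (hI3 : I3 * I3 = -1)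
    (hI12 : I1 * I2 = I3) (hI21 : I2 * I1 = -I3)
    (n : ℝ) (T U : V →ₗ[ℝ] V →ₗ[ℝ] ℝ)
    (hT : ∀ X Y : V,
      T X Y + T (I1 X) (I1 Y) + T (I2 X) (I2 Y) + T (I3 X) (I3 Y) = 0)
    (hU : ∀ X Y : V,
      3 * U X Y - U (I1 X) (I1 Y) - U (I2 X) (I2 Y) - U (I3 X) (I3 Y) = 0) :
    (∀ X Y : V,
      (torsionB n T U I3 X Y - torsionB n T U I3 (I1 X) (I1 Y)) +
        (torsionB n T U I1 X Y - torsionB n T U I1 (I2 X) (I2 Y)) +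
        (torsionB n T U I2 X Y - torsionB n T U I2 (I3 X) (I3 Y)) =
          8 * (n - 1) * T X Y) ∧
    (n ≠ 1 → ∀ X Y : V,
      T X Y = 1 / (8 * (n - 1)) *
        ((torsionB n T U I3 X Y - torsionB n T U I3 (I1 X) (I1 Y)) +
          (torsionB n T U I1 X Y - torsionB n T U I1 (I2 X) (I2 Y)) +
          (torsionB n T U I2 X Y - torsionB n T U I2 (I3 X) (I3 Y)))) := by
  have h31 : I3 * I1 = I2 := by
    have h13 : I1 * I3 = -I2 := by rw [← hI12, ← mul_assoc, hI1, neg_one_mul]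
    calc I3 * I1 = I1 * (I2 * I1) := by rw [← hI12, mul_assoc]
      _ = I2 := by rw [hI21, mul_neg, h13, neg_neg]
  have h23 : I2 * I3 = I1 := by
    rw [← neg_neg I3, ← hI21, mul_neg, ← mul_assoc, hI2, neg_one_mul, neg_neg]
  have a31 (x : V) : I3 (I1 x) = I2 x := LinearMap.congr_fun h31 x
  have a12 (x : V) : I1 (I2 x) = I3 x := LinearMap.congr_fun hI12 x
  have a23 (x : V) : I2 (I3 x) = I1 x := LinearMap.congr_fun h23 x
  have key : ∀ X Y : V,
      (torsionB n T U I3 X Y - torsionB n T U I3 (I1 X) (I1 Y)) +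
        (torsionB n T U I1 X Y - torsionB n T U I1 (I2 X) (I2 Y)) +
        (torsionB n T U I2 X Y - torsionB n T U I2 (I3 X) (I3 Y)) =
          8 * (n - 1) * T X Y := by
    intro X Y
    simp only [torsionB, a31, a12, a23]
    linear_combination (-2 * (n - 1)) * hT X Y + 8 * n * hU X Y
  refine ⟨key, fun hn X Y => ?_⟩
  rw [key]
  have hn' : n - 1 ≠ 0 := sub_ne_zero.mpr hn
  field_simp
end

section
/- Let V be a real vector space with quaternionic structure (I₁,I₂,I₃), let n be a real number with n ≠ 0 and n ≠ 1, let T⁰ be a bilinear form on V satisfying T⁰(X,Y) + T⁰(I₁X,I₁Y) + T⁰(I₂X,I₂Y) + T⁰(I₃X,I₃Y) = 0, and let U be a bilinear form on V satisfying 3U(X,Y) − U(I₁X,I₁Y) − U(I₂X,I₂Y) − U(I₃X,I₃Y) = 0. If for every k ∈ {1,2,3} and all X, Y ∈ V one has 2(n−1)[T⁰(X,Y) + T⁰(I_kX,I_kY)] + 8n U(X,Y) = 0, then T⁰ = 0 and U = 0. -/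
/-- the algebraic core of the implication i) ⇒ ii) of Theorem 1.1:
if `n ≠ 0`, `n ≠ 1` and for every `k ∈ {1,2,3}` one has
`2(n−1)[T⁰(X,Y) + T⁰(I_kX,I_kY)] + 8n U(X,Y) = 0` for all `X, Y`,
then `T⁰ = 0` and `U = 0`. -/
theorem torsion_vanishes_of_B_eq_zero
    {V : Type*} [AddCommGroup V] [Module ℝ V]
    (I1 I2 I3 : Module.End ℝ V)
    (hI1 : I1 * I1 = -1) (hI2 : I2 * I2 = -1) (hI3 : I3 * I3 = -1)
    (hI12 : I1 * I2 = I3) (hI21 : I2 * I1 = -I3)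
    (n : ℝ) (hn0 : n ≠ 0) (hn1 : n ≠ 1)
    (T U : V →ₗ[ℝ] V →ₗ[ℝ] ℝ)
    (hT : ∀ X Y : V,
      T X Y + T (I1 X) (I1 Y) + T (I2 X) (I2 Y) + T (I3 X) (I3 Y) = 0)
    (hU : ∀ X Y : V,
      3 * U X Y - U (I1 X) (I1 Y) - U (I2 X) (I2 Y) - U (I3 X) (I3 Y) = 0)
    (hB1 : ∀ X Y : V,
      2 * (n - 1) * (T X Y + T (I1 X) (I1 Y)) + 8 * n * U X Y = 0)
    (hB2 : ∀ X Y : V,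
      2 * (n - 1) * (T X Y + T (I2 X) (I2 Y)) + 8 * n * U X Y = 0)
    (hB3 : ∀ X Y : V,
      2 * (n - 1) * (T X Y + T (I3 X) (I3 Y)) + 8 * n * U X Y = 0) :
    T = 0 ∧ U = 0 := by
  have hTU : ∀ X Y : V, (n - 1) * T X Y = -6 * n * U X Y := fun X Y => by
    linear_combination (1 / 4) * (hB1 X Y + hB2 X Y + hB3 X Y) - (n - 1) / 2 * hT X Y
  have hU0 : ∀ X Y : V, U X Y = 0 := fun X Y => by
    have h : 4 * n * U X Y = 0 := by
      linear_combination n * hU X Y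
        - (1 / 12) * (hB1 X Y + hB2 X Y + hB3 X Y)
        + (1 / 6) * (3 * hTU X Y + hTU (I1 X) (I1 Y) + hTU (I2 X) (I2 Y) + hTU (I3 X) (I3 Y))
    exact (mul_eq_zero.mp h).resolve_left (mul_ne_zero four_ne_zero hn0)
  refine ⟨LinearMap.ext₂ fun X Y => ?_, LinearMap.ext₂ hU0⟩
  have h := hTU X Y
  rw [hU0, mul_zero] at h
  exact (mul_eq_zero.mp h).resolve_left (sub_ne_zero.mpr hn1)
end

section
/- Let V be a real vector space with quaternionic structure (I₁,I₂,I₃), let n be a real number with n ≠ 0, let T⁰ be a bilinear form on V satisfying T⁰(X,Y) + T⁰(I₁X,I₁Y) + T⁰(I₂X,I₂Y) + T⁰(I₃X,I₃Y) = 0, and let U be a bilinear form on V satisfying 3U(X,Y) − U(I₁X,I₁Y) − U(I₂X,I₂Y) − U(I₃X,I₃Y) = 0. Fix one cyclic permutation (i,j,k) of (1,2,3) and set B_k(X,Y) := 2(n−1)[T⁰(X,Y) + T⁰(I_kX,I_kY)] + 8n U(X,Y). If B_k(X,Y) + B_k(I_iX, I_iY) = 0 for all X, Y ∈ V, then U =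 0. -/
/-- the algebraic core of Corollary 4.2: for a fixed cyclic
permutation `(i,j,k)` of `(1,2,3)`, with
`B_k(X,Y) := 2(n−1)[T⁰(X,Y) + T⁰(I_kX,I_kY)] + 8n U(X,Y)`, if
`B_k(X,Y) + B_k(I_iX, I_iY) = 0` for all `X, Y` and `n ≠ 0`, then `U = 0`. -/
theorem U_vanishes_of_single_B_combination
    {V : Type*} [AddCommGroup V] [Module ℝ V]
    (I1 I2 I3 : Module.End ℝ V)
    (hI1 : I1 * I1 = -1) (hI2 : I2 * I2 = -1) (hI3 : I3 * I3 = -1)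
    (hI12 : I1 * I2 = I3) (hI21 : I2 * I1 = -I3)
    (n : ℝ) (hn : n ≠ 0)
    (T U : V →ₗ[ℝ] V →ₗ[ℝ] ℝ)
    (hT : ∀ X Y : V,
      T X Y + T (I1 X) (I1 Y) + T (I2 X) (I2 Y) + T (I3 X) (I3 Y) = 0)
    (hU : ∀ X Y : V,
      3 * U X Y - U (I1 X) (I1 Y) - U (I2 X) (I2 Y) - U (I3 X) (I3 Y) = 0)
    (Ii Ik : Module.End ℝ V)
    (hcyc : (Ii = I1 ∧ Ik = I3) ∨ (Ii = I2 ∧ Ik = I1) ∨ (Ii = I3 ∧ Ik = I2))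
    (hB : ∀ X Y : V,
      (2 * (n - 1) * (T X Y + T (Ik X) (Ik Y)) + 8 * n * U X Y) +
        (2 * (n - 1) * (T (Ii X) (Ii Y) + T (Ik (Ii X)) (Ik (Ii Y))) +
          8 * n * U (Ii X) (Ii Y)) = 0) :
    U = 0 := by
  have h11 (X : V) : I1 (I1 X) = -X := by simpa using LinearMap.congr_fun hI1 X
  have h22 (X : V) : I2 (I2 X) = -X := by simpa using LinearMap.congr_fun hI2 X
  have h33 (X : V) : I3 (I3 X) = -X := by simpa using LinearMap.congr_fun hI3 X
  have h12 (X : V) : I1 (I2 X) = I3 X := by simpa using LinearMap.congr_fun hI12 X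
  have h21 (X : V) : I2 (I1 X) = -I3 X := by simpa using LinearMap.congr_fun hI21 X
  have h31 (X : V) : I3 (I1 X) = I2 X := by rw [← neg_neg (I3 (I1 X)), ← h21, h11, map_neg, neg_neg]
  have h13 (X : V) : I1 (I3 X) = -I2 X := by rw [← h12, h11]
  have h32 (X : V) : I3 (I2 X) = -I1 X := by rw [← h12, h22, map_neg]
  have h23 (X : V) : I2 (I3 X) = I1 X := by
    rw [← neg_neg (I3 X), ← h21, map_neg, h22, neg_neg]
  ext X Y
  have hX := hU X Y
  have hX1 := hU (I1 X) (I1 Y)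
  have hX2 := hU (I2 X) (I2 Y)
  have hX3 := hU (I3 X) (I3 Y)
  have hTX := hT X Y
  have hBX := hB X Y
  have key : U X Y + U (Ii X) (Ii Y) = 0 := by
    refine (mul_eq_zero.mp ?_).resolve_left (mul_ne_zero (by norm_num : (8 : ℝ) ≠ 0) hn)
    rcases hcyc with ⟨rfl, rfl⟩ | ⟨rfl, rfl⟩ | ⟨rfl, rfl⟩ <;>
      simp only [h31, h12, h23] at hBX <;>
      linear_combination hBX - 2 * (n - 1) * hTX
  simp only [h11, h22, h33, h12, h21, h31, h13, h32, h23, map_neg, LinearMap.neg_apply,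
    neg_neg] at hX1 hX2 hX3
  rw [LinearMap.zero_apply, LinearMap.zero_apply]
  rcases hcyc with ⟨rfl, -⟩ | ⟨rfl, -⟩ | ⟨rfl, -⟩ <;> linarith
end
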